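/- Suppose M is totally real, so that r = n − 1. Let t := |E_p ∖ S_p|, where S_p ⊆ E_p is the subset determined by Γ. Assume the p-adic Schanuel Conjecture. Then rk_{ℤ_p}(\overline{Δ_Γ(Y)}) = r − (t−1)^+. -/

import Mathlib

open scoped NumberField
open Filter IsDedekindDomain

/-- The `p`-adic logarithm on a complete normed field `Cp` (a stand-in for `ℂ_p`), defined by
the power series `log_p x = ∑_{k ≥ 1} (-1)^(k+1) (x-1)^k / k` (convergent for `‖x - 1‖ < 1`). -/
noncomputable def plog (Cp : Type*) [NormedField Cp] (x : Cp) : Cp :=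
  ∑' k : ℕ, (-1) ^ (k + 1 + 1) * (x - 1) ^ (k + 1) / ((k : Cp) + 1)

/-- The `p`-adic Schanuel conjecture. -/
def PadicSchanuel (Cp : Type*) [NormedField Cp] [CharZero Cp] : Prop :=
  ∀ (m : ℕ) (α : Fin m → Cp),
    (∀ i, IsAlgebraic ℚ (α i)) → (∀ i, ‖α i - 1‖ < 1) →
    LinearIndependent ℚ (fun i => plog Cp (α i)) →
    AlgebraicIndependent ℚ (fun i => plog Cp (α i))

variable (p : ℕ) [Fact p.Prime] (M : Type*) [Field M] [NumberField M] [IsGalois ℚ M]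

/-- The image of a global unit in the completion `M_𝔭`. -/
noncomputable def locEmb (v : HeightOneSpectrum (𝓞 M)) (u : (𝓞 M)ˣ) :
    v.adicCompletion M :=
  algebraMap M (v.adicCompletion M) (algebraMap (𝓞 M) M u)

/-- `u ∈ Y = Δ_Γ⁻¹(∏_{𝔭∈Γ} O^*_{𝔭,1})`: the image of `u` in `O_𝔭^*` is a principal local
unit for every `𝔭 ∈ Γ`. -/
def MemY (Γ : Set (HeightOneSpectrum (𝓞 M))) (u : (𝓞 M)ˣ) : Prop :=
  ∀ v ∈ Γ, Valued.v (locEmb M v u - 1) < (1 : WithZero (Multiplicative ℤ))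

/-- `ZpRel p M Γ u a` says that `∏ⱼ Δ_Γ(uⱼ)^{aⱼ} = 1` in `∏_{𝔭∈Γ} M_𝔭`, where the `ℤ_p`-powers
of principal local units are defined by continuity: there are integers `c m j` with
`c m j → a j` in `ℤ_p` and `∏ⱼ uⱼ^{c m j} → 1` in `M_𝔭` for all `𝔭 ∈ Γ`. -/
def ZpRel (Γ : Set (HeightOneSpectrum (𝓞 M))) {k : ℕ} (u : Fin k → (𝓞 M)ˣ)
    (a : Fin k → ℤ_[p]) : Prop :=
  ∃ c : ℕ → Fin k → ℤ,
    (∀ j, Tendsto (fun m => ((c m j : ℤ_[p]))) atTop (nhds (a j))) ∧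
    ∀ v ∈ Γ, Tendsto (fun m => ∏ j, (locEmb M v (u j)) ^ (c m j)) atTop (nhds 1)

/-- The `ℤ_p`-rank of the topological closure of `Δ_Γ(Y)` in `∏_{𝔭∈Γ} O^*_{𝔭,1}`: the largest
`k` for which there exist `u₁, …, u_k ∈ Y` whose images under `Δ_Γ` are `ℤ_p`-linearly
independent. -/
noncomputable def ZpRankClosure (Γ : Set (HeightOneSpectrum (𝓞 M))) : ℕ :=
  sSup {k : ℕ | ∃ u : Fin k → (𝓞 M)ˣ, (∀ j, MemY M Γ (u j)) ∧
    ∀ a : Fin k → ℤ_[p], ZpRel p M Γ u a → a = 0}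

/-- The Galois action on the ring of integers of `M`. -/
noncomputable def gOhom (g : M ≃ₐ[ℚ] M) : 𝓞 M →+* 𝓞 M :=
  ((galRestrict ℤ ℚ M (𝓞 M)) g).toAlgHom.toRingHom

/-- The subset `S_p = {σ₀ ∘ g : g ∈ G, g⁻¹(𝔭₀) ∈ Γ} ⊆ E_p` determined by `Γ`, where
`σ₀ : M → M_{𝔭₀} → ℂ_p` is the composite of the canonical map with `ι`. -/
def SpOfGamma (Cp : Type*) [Field Cp] (Γ : Set (HeightOneSpectrum (𝓞 M)))
    (v0 : HeightOneSpectrum (𝓞 M)) (ι : v0.adicCompletion M →+* Cp) :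
    Set (M →+* Cp) :=
  {σ | ∃ g : M ≃ₐ[ℚ] M,
    σ = (ι.comp (algebraMap M (v0.adicCompletion M))).comp (g : M →+* M) ∧
    ∃ w ∈ Γ, w.asIdeal = Ideal.comap (gOhom M g) v0.asIdeal}

section PadicLogarithm

/-- The norm of a nonzero natural number in a valued extension of `ℚ_p` is at least `1 / k`. -/
lemma inv_norm_natCast_le {p : ℕ} [Fact p.Prime] {k : ℕ} (hk : k ≠ 0) :
    ‖(k : ℚ_[p])‖⁻¹ ≤ k := by
  have hk' : (k : ℚ_[p]) ≠ 0 := by exact_mod_cast hk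
  rw [Padic.norm_eq_zpow_neg_valuation hk', Padic.valuation_natCast, zpow_neg, inv_inv,
    zpow_natCast]
  exact_mod_cast Nat.le_of_dvd (Nat.pos_of_ne_zero hk) pow_padicValNat_dvd

variable {p : ℕ} [Fact p.Prime] {C : Type*} [NormedField C]

lemma norm_natCast_of_padic [Algebra ℚ_[p] C]
    (h : ∀ x : ℚ_[p], ‖algebraMap ℚ_[p] C x‖ = ‖x‖) (k : ℕ) : ‖(k : C)‖ = ‖(k : ℚ_[p])‖ := by
  rw [← h, map_natCast]

lemma isUltrametricDist_of_natCast (hN : ∀ k : ℕ, ‖(k : C)‖ = ‖(k : ℚ_[p])‖) :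
    IsUltrametricDist C :=
  IsUltrametricDist.isUltrametricDist_of_forall_norm_natCast_le_one fun k => by
    rw [hN]; exact_mod_cast (Padic.norm_int_le_one (p := p) (k : ℤ))

lemma norm_choose_div_le (hN : ∀ k : ℕ, ‖(k : C)‖ = ‖(k : ℚ_[p])‖) (a k : ℕ) :
    ‖(a.choose k : C) / ((k : C) + 1)‖ ≤ (k : ℝ) + 1 := by
  have h1 : ‖(a.choose k : C)‖ ≤ 1 := by
    rw [hN]; exact_mod_cast (Padic.norm_int_le_one (p := p) (a.choose k : ℤ))
  have h2 : ‖(k : C) + 1‖⁻¹ ≤ (k : ℝ) + 1 := by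
    have := inv_norm_natCast_le (p := p) (Nat.succ_ne_zero k)
    rw [← hN] at this
    exact_mod_cast this
  rw [norm_div, div_eq_mul_inv]
  calc _ ≤ 1 * ((k : ℝ) + 1) := by gcongr
    _ = _ := one_mul _

lemma norm_prime_pow_tendsto (hN : ∀ k : ℕ, ‖(k : C)‖ = ‖(k : ℚ_[p])‖) :
    Tendsto (fun m : ℕ => ((p : C) ^ m)) atTop (nhds 0) := by
  apply tendsto_pow_atTop_nhds_zero_of_norm_lt_one
  rw [hN]; exact Padic.norm_p_lt_one

variable [CharZero C]

/-- `p^m - 1` behaves like `-1` in binomial coefficients, in the `p`-adic limit. -/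
lemma tendsto_choose_prime_pow_sub_one (hN : ∀ k : ℕ, ‖(k : C)‖ = ‖(k : ℚ_[p])‖) (k : ℕ) :
    Tendsto (fun m : ℕ => ((p ^ m - 1).choose k : C)) atTop (nhds ((-1) ^ k)) := by
  induction k with
  | zero => simp
  | succ k ih =>
    have hq : ∀ m : ℕ, p ^ m - 1 + 1 = p ^ m := fun m =>
      Nat.sub_add_cancel (Nat.one_le_pow _ _ (Fact.out : p.Prime).pos)
    have key : ∀ m : ℕ, ((p ^ m - 1).choose (k + 1) : C)
        = (p : C) ^ m * ((p ^ m - 1).choose k : C) / ((k : C) + 1) - ((p ^ m - 1).choose k : C) := by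
      intro m
      have h1 := Nat.add_one_mul_choose_eq (p ^ m - 1) k
      have h2 := Nat.choose_succ_succ' (p ^ m - 1) k
      rw [hq] at h1 h2
      have h1' : (p : C) ^ m * ((p ^ m - 1).choose k : C)
        = ((p ^ m).choose (k + 1) : C) * ((k : C) + 1) := by exact_mod_cast h1
      have h2' : ((p ^ m).choose (k + 1) : C)
        = ((p ^ m - 1).choose k : C) + ((p ^ m - 1).choose (k + 1) : C) := by exact_mod_cast h2
      have hk : (k : C) + 1 ≠ 0 := by exact_mod_cast Nat.succ_ne_zero k
      rw [h1', mul_div_cancel_right₀ _ hk, h2']; ring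
    simp_rw [key]
    have := (((norm_prime_pow_tendsto hN).mul ih).div_const ((k : C) + 1)).sub ih
    simpa [pow_succ] using this

lemma one_add_pow_sub_one_div (y : C) {q : ℕ} (hq : 0 < q) :
    ((1 + y) ^ q - 1) / (q : C) = ∑' k : ℕ, ((q - 1).choose k : C) / ((k : C) + 1) * y ^ (k + 1) := by
  have hq0 : (q : C) ≠ 0 := by exact_mod_cast hq.ne'
  have hq1 : q - 1 + 1 = q := by omega
  rw [tsum_eq_sum (s := Finset.range q)]
  · rw [add_comm, add_pow, Finset.sum_range_succ']
    simp only [one_pow, mul_one, pow_zero, Nat.choose_zero_right, Nat.cast_one, add_sub_cancel_right,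
      Finset.sum_div]
    refine Finset.sum_congr rfl fun k _ => ?_
    have h1 := Nat.add_one_mul_choose_eq (q - 1) k
    rw [hq1] at h1
    have h1' : (q : C) * ((q - 1).choose k : C)
        = (q.choose (k + 1) : C) * ((k : C) + 1) := by exact_mod_cast h1
    have hk : (k : C) + 1 ≠ 0 := by exact_mod_cast Nat.succ_ne_zero k
    field_simp
    linear_combination (-(y ^ (k + 1))) * h1'
  · intro k hk
    rw [Nat.choose_eq_zero_of_lt (by simp at hk; omega)]
    simp

variable [CompleteSpace C]

/-- The `p`-adic logarithm is the limit of `(x ^ p^m - 1) / p^m`. -/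
lemma tendsto_plog (hN : ∀ k : ℕ, ‖(k : C)‖ = ‖(k : ℚ_[p])‖) {x : C} (hx : ‖x - 1‖ < 1) :
    Tendsto (fun m : ℕ => (x ^ (p ^ m) - 1) / ((p : C) ^ m)) atTop (nhds (plog C x)) := by
  have hpos : ∀ m : ℕ, 0 < p ^ m := fun m => pow_pos (Fact.out : p.Prime).pos m
  have key : ∀ m : ℕ, (x ^ (p ^ m) - 1) / ((p : C) ^ m)
      = ∑' k : ℕ, ((p ^ m - 1).choose k : C) / ((k : C) + 1) * (x - 1) ^ (k + 1) := fun m => by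
    rw [← one_add_pow_sub_one_div (x - 1) (hpos m)]
    simp
  simp_rw [key, plog]
  refine tendsto_tsum_of_dominated_convergence
    (bound := fun k : ℕ => ((k : ℝ) + 1) * ‖x - 1‖ ^ (k + 1)) ?_ ?_ ?_
  · have := (summable_pow_mul_geometric_of_norm_lt_one (R := ℝ) 1 (r := ‖x - 1‖) (by simpa using hx))
    simpa using (summable_nat_add_iff 1).2 this
  · intro k
    have := ((tendsto_choose_prime_pow_sub_one hN k).div_const ((k : C) + 1)).mul_const
      ((x - 1) ^ (k + 1))
    refine this.congr' ?_ |>.trans (le_of_eq ?_)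
    · rfl
    · congr 1; rw [pow_add, pow_add]; ring
  · refine Eventually.of_forall fun m k => ?_
    rw [norm_mul, norm_pow]
    gcongr
    exact norm_choose_div_le hN _ _

lemma plog_mul (hN : ∀ k : ℕ, ‖(k : C)‖ = ‖(k : ℚ_[p])‖) {x y : C} (hx : ‖x - 1‖ < 1)
    (hy : ‖y - 1‖ < 1) (hxy : ‖x * y - 1‖ < 1) : plog C (x * y) = plog C x + plog C y := by
  have hp0 : (p : C) ≠ 0 := by exact_mod_cast (Fact.out : p.Prime).ne_zero
  refine tendsto_nhds_unique (tendsto_plog hN hxy) ?_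
  have h1 := tendsto_plog hN hx
  have h2 := tendsto_plog hN hy
  have := (((norm_prime_pow_tendsto hN).mul h1).mul h2).add (h1.add h2)
  simp only [zero_mul, zero_add] at this
  refine this.congr fun m => ?_
  field_simp
  ring

/-- On the disc of radius `1/4` around `1` the logarithm is isometric. -/
lemma norm_plog (hN : ∀ k : ℕ, ‖(k : C)‖ = ‖(k : ℚ_[p])‖) {x : C} (hx : ‖x - 1‖ ≤ 1 / 4) :
    ‖plog C x‖ = ‖x - 1‖ := by
  have : IsUltrametricDist C := isUltrametricDist_of_natCast hN
  rcases eq_or_ne x 1 with rfl | hx1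
  · simp [plog]
  have hy : 0 < ‖x - 1‖ := by simpa [sub_eq_zero] using hx1
  have hp0 : (p : C) ≠ 0 := by exact_mod_cast (Fact.out : p.Prime).ne_zero
  refine tendsto_nhds_unique (tendsto_plog hN (by linarith)).norm ?_
  refine tendsto_const_nhds.congr fun m => ?_
  have hpos : 0 < p ^ m := pow_pos (Fact.out : p.Prime).pos m
  have key : (x ^ (p ^ m) - 1) / ((p : C) ^ m) = (x - 1) + ∑ k ∈ Finset.range (p ^ m - 1),
      (((p ^ m - 1).choose (k + 1) : C) / (((k + 1 : ℕ) : C) + 1)) * (x - 1) ^ (k + 2) := by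
    have := one_add_pow_sub_one_div (x - 1) hpos
    rw [add_sub_cancel] at this
    push_cast at this
    rw [this, tsum_eq_sum (s := Finset.range (p ^ m - 1 + 1)), Finset.sum_range_succ', add_comm]
    · simp
    · intro k hk
      rw [Nat.choose_eq_zero_of_lt (by simp at hk; omega)]
      simp
  rw [key]
  have hlt : ‖∑ k ∈ Finset.range (p ^ m - 1), (((p ^ m - 1).choose (k + 1) : C) /
      (((k + 1 : ℕ) : C) + 1)) * (x - 1) ^ (k + 2)‖ < ‖x - 1‖ := by
    refine lt_of_le_of_lt (IsUltrametricDist.norm_sum_le_of_forall_le_of_nonneg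
      (C := ‖x - 1‖ / 2) (by positivity) fun k hkr => ?_) (by linarith)
    have hk : ((k : ℝ) + 1 + 1) * (1 / 4) ^ (k + 1) ≤ 1 / 2 := by
      clear key hkr
      induction k with
      | zero => norm_num
      | succ k ih =>
        push_cast
        rw [pow_succ]
        have : (0 : ℝ) ≤ (1 / 4) ^ (k + 1) := by positivity
        have h0 : (0 : ℝ) ≤ k := by positivity
        nlinarith [mul_nonneg h0 this]
    rw [norm_mul, norm_pow]
    have h1 := norm_choose_div_le hN (p ^ m - 1) (k + 1)
    calc _ ≤ (((k + 1 : ℕ) : ℝ) + 1) * ‖x - 1‖ ^ (k + 2) := by gcongr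
      _ = ((k : ℝ) + 1 + 1) * ‖x - 1‖ ^ (k + 1) * ‖x - 1‖ := by push_cast; ring
      _ ≤ ((k : ℝ) + 1 + 1) * (1 / 4) ^ (k + 1) * ‖x - 1‖ := by gcongr
      _ ≤ 1 / 2 * ‖x - 1‖ := by gcongr
      _ = _ := by ring
  rw [IsUltrametricDist.norm_add_eq_max_of_norm_ne_norm hlt.ne', max_eq_left hlt.le]

end PadicLogarithm

section PrimesAndEmbeddings

variable {M : Type*} [Field M] [NumberField M] {C : Type*} [NormedField C]

/-- The embedding `τ` of `M` into a valued field induces the prime `v`. -/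
def InducesPrime (τ : M →+* C) (v : HeightOneSpectrum (𝓞 M)) : Prop :=
  ∀ x : 𝓞 M, x ∈ v.asIdeal ↔ ‖τ (algebraMap (𝓞 M) M x)‖ < 1

omit [NumberField M] in
lemma norm_integer_le_one [IsUltrametricDist C] (τ : M →+* C) (x : 𝓞 M) :
    ‖τ (algebraMap (𝓞 M) M x)‖ ≤ 1 := by
  have h : IsIntegral ℤ (τ (algebraMap (𝓞 M) M x)) :=
    (NumberField.RingOfIntegers.isIntegral_coe x).map (τ.toIntAlgHom)
  have h2 : IsIntegral (NormedField.valuation (K := C)).integer (τ (algebraMap (𝓞 M) M x)) :=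
    h.tower_top
  have := (Valuation.integer.integers (NormedField.valuation (K := C))).mem_of_integral h2
  rw [Valuation.mem_integer_iff] at this
  exact_mod_cast this

lemma InducesPrime.isEquiv [IsUltrametricDist C] {τ : M →+* C} {v : HeightOneSpectrum (𝓞 M)}
    (h : InducesPrime τ v) :
    (v.valuation M).IsEquiv ((NormedField.valuation (K := C)).comap τ) := by
  have hunit : ∀ d : v.asIdeal.primeCompl, ‖τ (algebraMap (𝓞 M) M d)‖ = 1 := fun d =>
    le_antisymm (norm_integer_le_one τ _) (not_lt.1 fun hlt => d.2 ((h _).2 hlt))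
  have hval : ∀ d : v.asIdeal.primeCompl, v.valuation M (algebraMap (𝓞 M) M d) = 1 := fun d => by
    rw [HeightOneSpectrum.valuation_of_algebraMap]
    exact (v.intValuation_eq_one_iff_mem_primeCompl d).2 d.2
  have hle : ∀ x : M, v.valuation M x ≤ 1 → ‖τ x‖ ≤ 1 := by
    intro x hx
    obtain ⟨n, d, hd⟩ := v.exists_primeCompl_mul_eq_of_integer x hx
    have := congrArg (fun y => ‖τ y‖) hd
    simp only [map_mul, norm_mul, hunit, mul_one] at this
    rw [this]; exact norm_integer_le_one τ n
  have hlt : ∀ x : M, v.valuation M x < 1 → ‖τ x‖ < 1 := by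
    intro x hx
    obtain ⟨n, d, hd⟩ := v.exists_primeCompl_mul_eq_of_integer x hx.le
    have h1 := congrArg (fun y => ‖τ y‖) hd
    have h2 := congrArg (v.valuation M) hd
    simp only [map_mul, norm_mul, hunit, mul_one] at h1
    rw [map_mul, hval, mul_one] at h2
    rw [h1, ← h, ← HeightOneSpectrum.valuation_lt_one_iff_mem (K := M), ← h2]
    exact hx
  rw [Valuation.isEquiv_iff_val_lt_one]
  intro x
  have e : ((NormedField.valuation (K := C)).comap τ) x < 1 ↔ ‖τ x‖ < 1 := Iff.rfl
  rw [e]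
  refine ⟨hlt x, fun hx => ?_⟩
  by_contra hge
  rw [not_lt] at hge
  have hx0 : x ≠ 0 := by rintro rfl; simp at hge
  have := hle x⁻¹ (by rw [map_inv₀]; exact inv_le_one_of_one_le₀ hge)
  rw [map_inv₀, norm_inv] at this
  have hpos : 0 < ‖τ x‖ := by simpa using hx0
  have := (inv_le_one₀ hpos).1 this
  linarith

lemma locEmb_prod (v : HeightOneSpectrum (𝓞 M)) {k : ℕ} (u : Fin k → (𝓞 M)ˣ) (c : Fin k → ℤ) :
    ∏ j, (locEmb M v (u j)) ^ (c j) = locEmb M v (∏ j, u j ^ c j) := by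
  let φ : (𝓞 M)ˣ →* v.adicCompletion M :=
    ((algebraMap M (v.adicCompletion M)).comp (algebraMap (𝓞 M) M)).toMonoidHom.comp
      (Units.coeHom (𝓞 M))
  have hφ : ∀ w, φ w = locEmb M v w := fun _ => rfl
  simp_rw [← hφ]
  rw [map_prod]
  refine Finset.prod_congr rfl fun j _ => ?_
  exact (map_zpow' φ (fun w => by
    apply eq_inv_of_mul_eq_one_left
    rw [← map_mul]; simp) _ _).symm

lemma valued_locEmb_sub_one (v : HeightOneSpectrum (𝓞 M)) (w : (𝓞 M)ˣ) :
    Valued.v (locEmb M v w - 1) = v.valuation M (algebraMap (𝓞 M) M w - 1) := by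
  rw [← HeightOneSpectrum.valuedAdicCompletion_eq_valuation', locEmb]
  congr 1
  have : ((algebraMap (𝓞 M) M w - 1 : M) : v.adicCompletion M)
    = algebraMap M (v.adicCompletion M) (algebraMap (𝓞 M) M w - 1) := rfl
  rw [this, map_sub, map_one]

lemma tendsto_locEmb_iff_valuation {p : ℕ} [Fact p.Prime] {v : HeightOneSpectrum (𝓞 M)}
    (hv : (p : 𝓞 M) ∈ v.asIdeal) (w : ℕ → (𝓞 M)ˣ) :
    Tendsto (fun m => locEmb M v (w m)) atTop (nhds 1) ↔
      ∀ N : ℕ, ∀ᶠ m in atTop,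
        v.valuation M (algebraMap (𝓞 M) M (w m) - 1) < v.valuation M ((p : M) ^ N) := by
  have hp0 : (p : M) ≠ 0 := by exact_mod_cast (Fact.out : p.Prime).ne_zero
  have hp1 : v.valuation M (p : M) < 1 := by
    have := (HeightOneSpectrum.valuation_lt_one_iff_mem (K := M) v (p : 𝓞 M)).2 hv
    simpa using this
  have hcoe : ∀ N : ℕ, Valued.v ((p : v.adicCompletion M) ^ N) = v.valuation M ((p : M) ^ N) := by
    intro N
    rw [← HeightOneSpectrum.valuedAdicCompletion_eq_valuation']
    have : (((p : M) ^ N : M) : v.adicCompletion M)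
      = algebraMap M (v.adicCompletion M) ((p : M) ^ N) := rfl
    rw [this, (algebraMap M (v.adicCompletion M)).map_pow,
      map_natCast (algebraMap M (v.adicCompletion M))]
  simp_rw [← valued_locEmb_sub_one, ← hcoe]
  constructor
  · intro h N
    have hN : Valued.v.restrict ((p : v.adicCompletion M) ^ N) ≠ 0 := by
      rw [Valuation.ne_zero_iff]
      exact pow_ne_zero _ (by
        rw [← map_natCast (algebraMap M (v.adicCompletion M))]
        exact (map_ne_zero _).2 hp0)
    have hmem : {y : v.adicCompletion M | Valued.v (y - 1) < Valued.v ((p : v.adicCompletion M) ^ N)}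
        ∈ nhds 1 := by
      refine Valued.mem_nhds.2 ⟨Units.mk0 _ hN, fun y hy => ?_⟩
      rw [Set.mem_ofPred_eq] at hy ⊢
      exact (Valuation.restrict_lt_iff _).1 hy
    exact h hmem
  · intro h
    rw [tendsto_def]
    intro s hs
    obtain ⟨γ, hγ⟩ := Valued.mem_nhds.1 hs
    have hγ0 : MonoidWithZeroHom.ValueGroup₀.embedding γ.1 ≠ 0 := by simp
    obtain ⟨N, hN⟩ := exists_pow_lt₀ hp1 (Units.mk0 _ hγ0)
    filter_upwards [h N] with m hm
    refine hγ ?_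
    rw [Set.mem_ofPred_eq, Valuation.restrict_lt_iff_lt_embedding]
    rw [hcoe, map_pow] at hm
    exact hm.trans hN

lemma InducesPrime.tendsto_iff [IsUltrametricDist C] {p : ℕ} [Fact p.Prime]
    (hN : ∀ k : ℕ, ‖(k : C)‖ = ‖(k : ℚ_[p])‖) {τ : M →+* C}
    {v : HeightOneSpectrum (𝓞 M)} (hv : (p : 𝓞 M) ∈ v.asIdeal) (h : InducesPrime τ v)
    (w : ℕ → (𝓞 M)ˣ) :
    Tendsto (fun m => locEmb M v (w m)) atTop (nhds 1) ↔
      Tendsto (fun m => ‖τ (algebraMap (𝓞 M) M (w m)) - 1‖) atTop (nhds 0) := by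
  rw [tendsto_locEmb_iff_valuation hv]
  have key : ∀ (N : ℕ) m, v.valuation M (algebraMap (𝓞 M) M (w m) - 1) < v.valuation M ((p : M) ^ N)
      ↔ ‖τ (algebraMap (𝓞 M) M (w m)) - 1‖ < ‖(p : C)‖ ^ N := by
    intro N m
    rw [h.isEquiv.lt_iff_lt]
    have : ∀ x y : M, ((NormedField.valuation (K := C)).comap τ) x
      < ((NormedField.valuation (K := C)).comap τ) y ↔ ‖τ x‖ < ‖τ y‖ := fun _ _ => Iff.rfl
    rw [this]; simp
  simp_rw [key]
  have hp1 : ‖(p : C)‖ < 1 := by rw [hN]; exact Padic.norm_p_lt_one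
  have hp0 : 0 < ‖(p : C)‖ := by
    rw [hN]; simpa using (Fact.out : p.Prime).pos
  constructor
  · intro h
    rw [Metric.tendsto_nhds]
    intro ε hε
    obtain ⟨N, hlt⟩ := exists_pow_lt_of_lt_one hε hp1
    filter_upwards [h N] with m hm
    rw [dist_zero_right, norm_norm]
    exact hm.trans hlt
  · intro h N
    exact h.eventually_lt_const (pow_pos hp0 N)

omit [NumberField M] in
lemma InducesPrime.unique {τ : M →+* C} {v w : HeightOneSpectrum (𝓞 M)}
    (h : InducesPrime τ v) (h' : InducesPrime τ w) : v = w := by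
  ext x; rw [h, h']

variable [IsGalois ℚ M]

lemma inducesPrime_comp_iff {τ : M →+* C} {v w : HeightOneSpectrum (𝓞 M)}
    (h : InducesPrime τ v) (g : M ≃ₐ[ℚ] M) :
    InducesPrime (τ.comp (g : M →+* M)) w ↔ w.asIdeal = Ideal.comap (gOhom M g) v.asIdeal := by
  have hg : ∀ x, algebraMap (𝓞 M) M (gOhom M g x) = g (algebraMap (𝓞 M) M x) :=
    algebraMap_galRestrict_apply ℤ g
  simp only [InducesPrime, Ideal.ext_iff, Ideal.mem_comap, h _, hg]
  rfl

lemma exists_inducesPrime [IsAlgClosed C] [CharZero C] [IsUltrametricDist C] {p : ℕ}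
    [Fact p.Prime] (hN : ∀ k : ℕ, ‖(k : C)‖ = ‖(k : ℚ_[p])‖) {v : HeightOneSpectrum (𝓞 M)}
    (hv : (p : 𝓞 M) ∈ v.asIdeal) : ∃ τ : M →+* C, InducesPrime τ v := by
  let _ : Algebra ℚ C := DivisionRing.toRatAlgebra
  let τ₁ : M →+* C := (IsAlgClosed.lift : M →ₐ[ℚ] C).toRingHom
  let P : Ideal (𝓞 M) :=
    { carrier := {x | ‖τ₁ (algebraMap (𝓞 M) M x)‖ < 1}
      add_mem' := fun {a b} ha hb => by
        simp only [Set.mem_ofPred_eq, map_add] at *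
        exact (IsUltrametricDist.norm_add_le_max _ _).trans_lt (max_lt ha hb)
      zero_mem' := by simp
      smul_mem' := fun c x hx => by
        simp only [Set.mem_ofPred_eq, smul_eq_mul, map_mul, norm_mul] at *
        exact mul_lt_one_of_nonneg_of_lt_one_right (norm_integer_le_one _ _) (norm_nonneg _) hx }
  have hP : ∀ x, x ∈ P ↔ ‖τ₁ (algebraMap (𝓞 M) M x)‖ < 1 := fun _ => Iff.rfl
  have hPp : P.IsPrime := by
    refine ⟨fun htop => ?_, fun {x y} hxy => ?_⟩
    · have : (1 : 𝓞 M) ∈ P := htop ▸ Submodule.mem_top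
      rw [hP] at this; simp at this
    · rw [hP, map_mul, map_mul, norm_mul] at hxy
      rw [hP, hP]
      by_contra! hcon
      have := one_le_mul_of_one_le_of_one_le hcon.1 hcon.2
      linarith
  have hpP : (p : 𝓞 M) ∈ P := by
    rw [hP]; simp only [map_natCast]; rw [hN]; exact Padic.norm_p_lt_one
  have hlies : ∀ Q : Ideal (𝓞 M), Q.IsPrime → (p : 𝓞 M) ∈ Q →
      Q ∈ Ideal.primesOver (Ideal.span {(p : ℤ)}) (𝓞 M) := by
    intro Q hQ hpQ
    refine ⟨hQ, ⟨?_⟩⟩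
    have hmax : (Ideal.span {(p : ℤ)}).IsMaximal :=
      PrincipalIdealRing.isMaximal_of_irreducible
        (Nat.prime_iff_prime_int.1 (Fact.out : p.Prime)).irreducible
    refine hmax.eq_of_le (Ideal.IsPrime.under ℤ Q).ne_top ?_
    rw [Ideal.span_singleton_le_iff_mem, Ideal.under_def, Ideal.mem_comap]
    simpa using hpQ
  obtain ⟨g, hg⟩ := Ideal.exists_comap_galRestrict_eq ℤ ℚ M (𝓞 M) (hlies P hPp hpP)
    (hlies v.asIdeal v.isPrime hv)
  refine ⟨τ₁.comp (g : M →+* M), fun x => ?_⟩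
  rw [← hg, Ideal.mem_comap, hP, algebraMap_galRestrict_apply]
  rfl

end PrimesAndEmbeddings

section GlobalUnits

variable {M : Type*} [Field M] [NumberField M]

omit [NumberField M] in
lemma units_ext_algebraMap {u w : (𝓞 M)ˣ}
    (h : algebraMap (𝓞 M) M u = algebraMap (𝓞 M) M w) : u = w :=
  Units.ext (NumberField.RingOfIntegers.ext h)

section Galois

variable [IsGalois ℚ M]

/-- The Galois action on global units. -/
noncomputable def galUnit (g : M ≃ₐ[ℚ] M) : (𝓞 M)ˣ →* (𝓞 M)ˣ :=
  Units.map (gOhom M g).toMonoidHom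

lemma coe_galUnit (g : M ≃ₐ[ℚ] M) (u : (𝓞 M)ˣ) :
    algebraMap (𝓞 M) M (galUnit g u) = g (algebraMap (𝓞 M) M u) :=
  algebraMap_galRestrict_apply (B := 𝓞 M) ℤ g (u : 𝓞 M)

lemma galUnit_galUnit (g h : M ≃ₐ[ℚ] M) (u : (𝓞 M)ˣ) :
    galUnit g (galUnit h u) = galUnit (g * h) u := by
  apply units_ext_algebraMap
  simp only [coe_galUnit, AlgEquiv.mul_apply]

lemma sq_prod_galUnit (u : (𝓞 M)ˣ) :
    (∏ g : M ≃ₐ[ℚ] M, galUnit g u) ^ 2 = 1 := by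
  apply units_ext_algebraMap
  have h1 : algebraMap (𝓞 M) M ((∏ g : M ≃ₐ[ℚ] M, galUnit g u : (𝓞 M)ˣ) : 𝓞 M)
      = algebraMap ℚ M (Algebra.norm ℚ (algebraMap (𝓞 M) M u)) := by
    rw [Algebra.norm_eq_prod_automorphisms, Units.coe_prod, map_prod]
    exact Finset.prod_congr rfl fun g _ => coe_galUnit g u
  have h2 : |(RingOfIntegers.norm ℚ (u : 𝓞 M) : ℚ)| = 1 :=
    NumberField.isUnit_iff_norm.1 u.isUnit
  rw [RingOfIntegers.coe_norm] at h2
  rw [Units.val_pow_eq_pow_val, map_pow, h1, ← map_pow, ← sq_abs, h2]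
  simp

/-- In a totally real Galois field there is a unit whose conjugates only satisfy the norm
relation. -/
lemma exists_unit_galois_independent (htr : ∀ (τ : M →+* ℂ) (x : M), (τ x).im = 0) :
    ∃ u : (𝓞 M)ˣ, ∀ c : (M ≃ₐ[ℚ] M) → ℤ, ∏ g, galUnit g u ^ c g = 1 → ∀ g h, c g = c h := by
  let w : NumberField.InfinitePlace M := Classical.arbitrary _
  obtain ⟨u, hu⟩ := NumberField.Units.dirichletUnitTheorem.exists_unit M w
  let l : (M ≃ₐ[ℚ] M) → ℝ := fun g => Real.log (w (algebraMap (𝓞 M) M (galUnit g u)))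
  have hne : ∀ v : (𝓞 M)ˣ, w (algebraMap (𝓞 M) M v) ≠ 0 := fun v => by simp
  have hprod : ∀ (f : (M ≃ₐ[ℚ] M) → (𝓞 M)ˣ) (c : (M ≃ₐ[ℚ] M) → ℤ),
      Real.log (w (algebraMap (𝓞 M) M (∏ g, f g ^ c g : (𝓞 M)ˣ)))
        = ∑ g, (c g : ℝ) * Real.log (w (algebraMap (𝓞 M) M (f g))) := by
    intro f c
    rw [Units.coe_prod, map_prod, map_prod, Real.log_prod]
    · refine Finset.sum_congr rfl fun g _ => ?_
      rw [← Real.log_zpow]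
      congr 1
      rw [← map_zpow₀, ← NumberField.Units.coe_zpow]
    · exact fun g _ => hne _
  have hneg : ∀ g, g ≠ 1 → l g < 0 := by
    intro g hg
    have h1 : l g = Real.log ((w.comap (g : M →+* M)) (algebraMap (𝓞 M) M u)) := by
      simp only [l, coe_galUnit]; rfl
    rw [h1]
    refine hu _ fun hw => hg ?_
    rw [← NumberField.InfinitePlace.mk_embedding w, NumberField.InfinitePlace.comap_mk,
      NumberField.InfinitePlace.mk_eq_iff] at hw
    have hw' : w.embedding.comp (g : M →+* M) = w.embedding := by
      rcases hw with hw | hw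
      · exact hw
      · refine Eq.trans ?_ hw
        ext x
        rw [NumberField.ComplexEmbedding.conjugate_coe_eq]
        exact (Complex.conj_eq_iff_im.2 (htr _ x)).symm
    ext x
    exact w.embedding.injective (DFunLike.congr_fun hw' x)
  have hsum : ∑ g, l g = 0 := by
    have h1 := hprod (fun g => galUnit g u) (fun _ => 2)
    have h2 : ∏ g : M ≃ₐ[ℚ] M, galUnit g u ^ (2 : ℤ) = 1 := by
      rw [Finset.prod_zpow]; exact_mod_cast sq_prod_galUnit u
    rw [h2] at h1
    simp only [← Finset.mul_sum] at h1
    simpa using h1.symm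
  refine ⟨u, fun c hc => ?_⟩
  obtain ⟨g₀, -, hg₀⟩ := Finset.exists_max_image Finset.univ c ⟨1, Finset.mem_univ _⟩
  have hrel : ∑ g, (c g : ℝ) * l (g₀⁻¹ * g) = 0 := by
    have h1 := congrArg (galUnit g₀⁻¹) hc
    simp only [map_prod, map_zpow, galUnit_galUnit, map_one] at h1
    have h2 := hprod (fun g => galUnit (g₀⁻¹ * g) u) c
    rw [h1] at h2
    simpa using h2.symm
  have hsum' : ∑ g, l (g₀⁻¹ * g) = 0 := by
    rw [← hsum]; exact Fintype.sum_equiv (Equiv.mulLeft g₀⁻¹) _ _ fun _ => rfl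
  have hzero : ∑ g, ((c g : ℝ) - c g₀) * l (g₀⁻¹ * g) = 0 := by
    simp only [sub_mul, Finset.sum_sub_distrib, ← Finset.mul_sum, hrel, hsum']; ring
  have hnn : ∀ g ∈ Finset.univ, 0 ≤ ((c g : ℝ) - c g₀) * l (g₀⁻¹ * g) := by
    intro g _
    rcases eq_or_ne g g₀ with rfl | hg
    · simp
    · have h1 : (c g : ℝ) ≤ c g₀ := by exact_mod_cast hg₀ g (Finset.mem_univ _)
      have h2 := hneg (g₀⁻¹ * g) (fun h => hg (by rw [inv_mul_eq_one] at h; exact h.symm))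
      nlinarith
  have hall : ∀ g, c g = c g₀ := by
    intro g
    rcases eq_or_ne g g₀ with rfl | hg
    · rfl
    have h1 := (Finset.sum_eq_zero_iff_of_nonneg hnn).1 hzero g (Finset.mem_univ _)
    have h2 := hneg (g₀⁻¹ * g) (fun h => hg (by rw [inv_mul_eq_one] at h; exact h.symm))
    have h3 := (mul_eq_zero.1 h1).resolve_right h2.ne
    exact_mod_cast sub_eq_zero.1 h3
  exact fun g h => (hall g).trans (hall h).symm

lemma card_galois_eq_rank_add_one (htr : ∀ (τ : M →+* ℂ) (x : M), (τ x).im = 0) :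
    Nat.card (M ≃ₐ[ℚ] M) = NumberField.Units.rank M + 1 := by
  have : NumberField.IsTotallyReal M := ⟨fun w => by
    rw [NumberField.InfinitePlace.isReal_iff, NumberField.ComplexEmbedding.isReal_iff]
    ext x
    rw [NumberField.ComplexEmbedding.conjugate_coe_eq]
    exact Complex.conj_eq_iff_im.2 (htr _ x)⟩
  rw [IsGalois.card_aut_eq_finrank, NumberField.Units.rank,
    Nat.sub_add_cancel Fintype.card_pos, NumberField.IsTotallyReal.finrank,
    NumberField.InfinitePlace.card_eq_nrRealPlaces_add_nrComplexPlaces,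
    NumberField.IsTotallyReal.nrComplexPlaces_eq_zero, add_zero]

end Galois

/-- More than `rank` many units are multiplicatively dependent. -/
lemma exists_unit_relation {k : ℕ} (hk : NumberField.Units.rank M < k) (u : Fin k → (𝓞 M)ˣ) :
    ∃ c : Fin k → ℤ, c ≠ 0 ∧ ∏ j, u j ^ c j = 1 := by
  have hdep : ¬ LinearIndependent ℤ (fun j => Additive.ofMul (u j)) := fun h => by
    have := h.fintype_card_le_finrank
    rw [NumberField.Units.finrank_eq, Fintype.card_fin] at this
    omega
  rw [Fintype.not_linearIndependent_iff] at hdep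
  obtain ⟨c, hc, i, hi⟩ := hdep
  refine ⟨c, fun h => hi (congrFun h i), ?_⟩
  simpa using congrArg Additive.toMul hc

/-- The global units congruent to `1` modulo `p²`. -/
noncomputable def congrUnits (p : ℕ) (M : Type*) [Field M] : Subgroup (𝓞 M)ˣ :=
  (Units.map (Ideal.Quotient.mk (Ideal.span {(p : 𝓞 M) ^ 2})).toMonoidHom).ker

omit [NumberField M] in
lemma mem_congrUnits {p : ℕ} {u : (𝓞 M)ˣ} :
    u ∈ congrUnits p M ↔ (p : 𝓞 M) ^ 2 ∣ (u : 𝓞 M) - 1 := by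
  rw [congrUnits, MonoidHom.mem_ker, Units.ext_iff, ← Ideal.mem_span_singleton,
    ← Ideal.Quotient.eq]
  simp

lemma exists_pow_mem_congrUnits (p : ℕ) [Fact p.Prime] :
    ∃ N : ℕ, 0 < N ∧ ∀ u : (𝓞 M)ˣ, u ^ N ∈ congrUnits p M := by
  have hp0 : (p : 𝓞 M) ≠ 0 := by exact_mod_cast (Fact.out : p.Prime).ne_zero
  have : Finite (𝓞 M ⧸ Ideal.span {(p : 𝓞 M) ^ 2}) :=
    Ideal.finiteQuotientOfFreeOfNeBot _ (by simpa using hp0)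
  refine ⟨Nat.card (𝓞 M ⧸ Ideal.span {(p : 𝓞 M) ^ 2})ˣ, Nat.card_pos, fun u => ?_⟩
  rw [congrUnits, MonoidHom.mem_ker, map_pow, pow_card_eq_one']

end GlobalUnits

section UnitLogarithms

variable {p : ℕ} [Fact p.Prime] {M : Type*} [Field M] {C : Type*} [NormedField C]

lemma norm_unit_sub_one_le (hN : ∀ k : ℕ, ‖(k : C)‖ = ‖(k : ℚ_[p])‖) (τ : M →+* C)
    {u : (𝓞 M)ˣ} (hu : u ∈ congrUnits p M) : ‖τ (algebraMap (𝓞 M) M u) - 1‖ ≤ 1 / 4 := by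
  have : IsUltrametricDist C := isUltrametricDist_of_natCast hN
  obtain ⟨z, hz⟩ := mem_congrUnits.1 hu
  have h1 : τ (algebraMap (𝓞 M) M u) - 1 = (p : C) ^ 2 * τ (algebraMap (𝓞 M) M z) := by
    have := congrArg (fun x => τ (algebraMap (𝓞 M) M x)) hz
    simpa using this
  have h2 : ‖(p : C)‖ ≤ 1 / 2 := by
    rw [hN, Padic.norm_p, one_div]
    have : (2 : ℝ) ≤ p := by exact_mod_cast (Fact.out : p.Prime).two_le
    gcongr
  rw [h1, norm_mul, norm_pow]
  calc _ ≤ (1 / 2 : ℝ) ^ 2 * 1 := by gcongr; exact norm_integer_le_one τ z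
    _ = _ := by norm_num

variable [CompleteSpace C] [CharZero C]

lemma plog_unit_prod (hN : ∀ k : ℕ, ‖(k : C)‖ = ‖(k : ℚ_[p])‖) (τ : M →+* C) {ι : Type*}
    (s : Finset ι) {u : ι → (𝓞 M)ˣ} (hu : ∀ i, u i ∈ congrUnits p M) (c : ι → ℤ) :
    plog C (τ (algebraMap (𝓞 M) M (∏ i ∈ s, u i ^ c i : (𝓞 M)ˣ)))
      = ∑ i ∈ s, (c i : C) * plog C (τ (algebraMap (𝓞 M) M (u i))) := by
  have hlt : ∀ w : (𝓞 M)ˣ, w ∈ congrUnits p M → ‖τ (algebraMap (𝓞 M) M w) - 1‖ < 1 := fun w hw =>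
    (norm_unit_sub_one_le hN τ hw).trans_lt (by norm_num)
  let L : Additive (congrUnits p M) →+ C := AddMonoidHom.mk'
    (fun w => plog C (τ (algebraMap (𝓞 M) M (w.toMul : (𝓞 M)ˣ)))) fun a b => by
      have hab := hlt _ (a.toMul * b.toMul).2
      simp only [toMul_add, Subgroup.coe_mul, Units.val_mul, map_mul] at hab ⊢
      exact plog_mul hN (hlt _ a.toMul.2) (hlt _ b.toMul.2) hab
  have := map_sum L (fun i => c i • Additive.ofMul (⟨u i, hu i⟩ : congrUnits p M)) s
  simp only [map_zsmul, zsmul_eq_mul] at this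
  simpa only [L, AddMonoidHom.mk'_apply, toMul_sum, toMul_zsmul, toMul_ofMul,
    Subgroup.val_finsetProd, SubgroupClass.coe_zpow] using this

variable [Algebra ℚ_[p] C]

/-- A product of `p`-adic powers of global units is `1` in `M_v` if and only if the corresponding
combination of logarithms vanishes. -/
lemma tendsto_locEmb_prod_iff [NumberField M] (hpadic : ∀ x : ℚ_[p], ‖algebraMap ℚ_[p] C x‖ = ‖x‖)
    {τ : M →+* C} {v : HeightOneSpectrum (𝓞 M)} (hv : (p : 𝓞 M) ∈ v.asIdeal)
    (h : InducesPrime τ v) {k : ℕ} {u : Fin k → (𝓞 M)ˣ} (hu : ∀ j, u j ∈ congrUnits p M)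
    {a : Fin k → ℤ_[p]} {c : ℕ → Fin k → ℤ}
    (hc : ∀ j, Tendsto (fun m => ((c m j : ℤ_[p]))) atTop (nhds (a j))) :
    Tendsto (fun m => ∏ j, (locEmb M v (u j)) ^ (c m j)) atTop (nhds 1) ↔
      ∑ j, algebraMap ℚ_[p] C (a j) * plog C (τ (algebraMap (𝓞 M) M (u j))) = 0 := by
  have hN := norm_natCast_of_padic hpadic
  have : IsUltrametricDist C := isUltrametricDist_of_natCast hN
  have hcont : Continuous (algebraMap ℚ_[p] C) :=
    (AddMonoidHomClass.isometry_of_norm (algebraMap ℚ_[p] C) hpadic).continuous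
  have hlim : Tendsto (fun m => ∑ j, (c m j : C) * plog C (τ (algebraMap (𝓞 M) M (u j)))) atTop
      (nhds (∑ j, algebraMap ℚ_[p] C (a j) * plog C (τ (algebraMap (𝓞 M) M (u j))))) := by
    refine tendsto_finsetSum _ fun j _ => Tendsto.mul_const _ ?_
    have h1 := (hcont.tendsto _).comp ((continuous_subtype_val.tendsto (a j)).comp (hc j))
    refine h1.congr fun m => ?_
    change algebraMap ℚ_[p] C (((c m j : ℤ_[p]) : ℚ_[p])) = _
    rw [PadicInt.coe_intCast, map_intCast]
  have hmem : ∀ m, ∏ j, u j ^ c m j ∈ congrUnits p M := fun m =>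
    Subgroup.prod_mem _ fun j _ => Subgroup.zpow_mem _ (hu j) _
  simp_rw [locEmb_prod]
  rw [h.tendsto_iff hN hv]
  simp_rw [← norm_plog hN (norm_unit_sub_one_le hN τ (hmem _)), plog_unit_prod hN τ _ hu]
  rw [← tendsto_zero_iff_norm_tendsto_zero]
  exact ⟨fun h0 => tendsto_nhds_unique hlim h0, fun h0 => h0 ▸ hlim⟩

end UnitLogarithms

lemma exists_int_seq_tendsto {p : ℕ} [Fact p.Prime] {k : ℕ} (a : Fin k → ℤ_[p]) :
    ∃ c : ℕ → Fin k → ℤ, ∀ j, Tendsto (fun m => ((c m j : ℤ_[p]))) atTop (nhds (a j)) := by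
  have h : ∀ j, ∃ c : ℕ → ℤ, Tendsto (fun m => (c m : ℤ_[p])) atTop (nhds (a j)) := fun j => by
    obtain ⟨x, hx, hlim⟩ := mem_closure_iff_seq_limit.1 (PadicInt.denseRange_intCast (p := p) (a j))
    choose c hc using hx
    exact ⟨c, by simpa [hc] using hlim⟩
  choose c hc using h
  exact ⟨fun m j => c j m, hc⟩

section UpperBound

variable {p : ℕ} [Fact p.Prime] {M : Type*} [Field M] [NumberField M] {C : Type*} [NormedField C]
  [CompleteSpace C] [CharZero C] [IsAlgClosed C] [Algebra ℚ_[p] C]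

/-- The logarithms of the principal units at a prime `v` span a `ℚ_p`-space of dimension at most
the number of embeddings inducing `v`. -/
lemma exists_submodule_plog_mem (hpadic : ∀ x : ℚ_[p], ‖algebraMap ℚ_[p] C x‖ = ‖x‖)
    {τ : M →+* C} {v : HeightOneSpectrum (𝓞 M)} (h : InducesPrime τ v) :
    ∃ L : Submodule ℚ_[p] C, FiniteDimensional ℚ_[p] L ∧
      Module.finrank ℚ_[p] L ≤ Nat.card {σ : M →+* C // InducesPrime σ v} ∧
      ∀ x : M, ‖τ x - 1‖ < 1 → plog C (τ x) ∈ L := by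
  have hN := norm_natCast_of_padic hpadic
  have : IsUltrametricDist C := isUltrametricDist_of_natCast hN
  let _ : NormedAlgebra ℚ_[p] C :=
    { ‹Algebra ℚ_[p] C› with
      norm_smul_le := fun r x => by rw [Algebra.smul_def, norm_mul, hpadic] }
  let b := Module.finBasis ℚ M
  let S : Set C := Set.range (τ ∘ b)
  have hfin : Finite S := Set.finite_range _
  have h_int : ∀ x : M, IsIntegral ℚ_[p] (τ x) := fun x => by
    have h1 : IsIntegral ℚ x := Algebra.IsIntegral.isIntegral x
    have h2 : IsIntegral ℚ (τ x) := h1.map τ.toRatAlgHom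
    exact h2.tower_top
  let L : IntermediateField ℚ_[p] C := IntermediateField.adjoin ℚ_[p] S
  have hfd : FiniteDimensional ℚ_[p] L := by
    apply IntermediateField.finiteDimensional_adjoin
    rintro _ ⟨i, rfl⟩
    exact h_int _
  have hexp : ∀ x : M, x = ∑ i, algebraMap ℚ M (b.repr x i) * b i := fun x => by
    conv_lhs => rw [← b.sum_repr x]
    simp only [Algebra.smul_def]
  have hmem : ∀ x : M, τ x ∈ L := fun x => by
    rw [hexp x, map_sum]
    refine L.sum_mem fun i _ => ?_
    rw [map_mul, eq_ratCast, map_ratCast]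
    exact L.mul_mem (SubfieldClass.ratCast_mem L _) (IntermediateField.subset_adjoin _ _ ⟨i, rfl⟩)
  have hnorm : ∀ (φ : L →ₐ[ℚ_[p]] C) (x : L), ‖φ x‖ = ‖(x : C)‖ := fun φ x => by
    let f : (L →ₐ[ℚ_[p]] C) → AbsoluteValue L ℝ := fun ψ =>
      (NormedField.toAbsoluteValue C).comp (f := ψ.toRingHom) ψ.toRingHom.injective
    have hf : ∀ ψ, f ψ x = spectralNorm ℚ_[p] L x := fun ψ =>
      spectralNorm_unique_field_norm_ext (f := f ψ) (fun y => by
        change ‖ψ (algebraMap ℚ_[p] L y)‖ = _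
        rw [AlgHom.commutes, hpadic]) x
    exact (hf φ).trans (hf L.val).symm
  refine ⟨L.toSubmodule, hfd, ?_, fun x hx => ?_⟩
  · have hcard : Module.finrank ℚ_[p] L = Nat.card (L →ₐ[ℚ_[p]] C) := by
      rw [Nat.card_eq_fintype_card, AlgHom.card]
    refine hcard.trans_le ?_
    let τL : M →+* L := τ.codRestrict L hmem
    refine Nat.card_le_card_of_injective
      (fun φ => (⟨(φ : L →+* C).comp τL, fun x => ?_⟩ : {σ : M →+* C // InducesPrime σ v})) ?_
    · rw [h x]
      have := hnorm φ (τL (algebraMap (𝓞 M) M x))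
      exact (congrArg (· < (1 : ℝ)) this.symm).to_iff
    · intro φ ψ hφψ
      refine IntermediateField.algHom_ext_of_eq_adjoin _ (rfl : L = _) ?_
      rintro _ ⟨i, rfl⟩
      exact DFunLike.congr_fun (Subtype.ext_iff.1 hφψ) (b i)
  · have hcl : IsClosed (L.toSubmodule : Set C) := Submodule.closed_of_finiteDimensional _
    refine hcl.mem_of_tendsto (tendsto_plog hN hx) (Eventually.of_forall fun m => ?_)
    change _ ∈ L
    exact div_mem (sub_mem (pow_mem (hmem x) _) (one_mem L)) (pow_mem (natCast_mem L p) m)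

lemma le_card_inducesPrime_of_independent [IsGalois ℚ M]
    (hpadic : ∀ x : ℚ_[p], ‖algebraMap ℚ_[p] C x‖ = ‖x‖) {Γ : Set (HeightOneSpectrum (𝓞 M))}
    (hΓp : ∀ v ∈ Γ, (p : 𝓞 M) ∈ v.asIdeal) {k : ℕ} {u : Fin k → (𝓞 M)ˣ}
    (hu : ∀ a : Fin k → ℤ_[p], ZpRel p M Γ u a → a = 0) :
    k ≤ Nat.card {σ : M →+* C // ∃ w ∈ Γ, InducesPrime σ w} := by
  have hN := norm_natCast_of_padic hpadic
  have : IsUltrametricDist C := isUltrametricDist_of_natCast hN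
  obtain ⟨N, hN0, hNu⟩ := exists_pow_mem_congrUnits (M := M) p
  choose τ hτ using fun w : Γ => exists_inducesPrime (C := C) hN (hΓp w w.2)
  choose L hLfd hLcard hLmem using fun w : Γ => exists_submodule_plog_mem hpadic (hτ w)
  have hinj : Function.Injective τ := fun w w' hw =>
    Subtype.ext ((hτ w).unique (hw ▸ hτ w'))
  have : Finite Γ := Finite.of_injective τ hinj
  let _ : Fintype Γ := Fintype.ofFinite Γ
  have hsum : ∑ w : Γ, Nat.card {σ : M →+* C // InducesPrime σ w.1}
      ≤ Nat.card {σ : M →+* C // ∃ w ∈ Γ, InducesPrime σ w} := by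
    rw [← Nat.card_sigma]
    refine Nat.card_le_card_of_injective
      (fun x : Σ w : Γ, {σ : M →+* C // InducesPrime σ w.1} =>
        (⟨x.2.1, x.1.1, x.1.2, x.2.2⟩ : {σ : M →+* C // ∃ w ∈ Γ, InducesPrime σ w})) ?_
    rintro ⟨w, σ, hσ⟩ ⟨w', σ', hσ'⟩ heq
    obtain rfl : σ = σ' := congrArg Subtype.val heq
    obtain rfl : w = w' := Subtype.ext (hσ.unique hσ')
    rfl
  by_contra! hlt
  let f : Fin k → ((w : Γ) → L w) := fun j w =>
    ⟨plog C (τ w (algebraMap (𝓞 M) M (u j ^ N : (𝓞 M)ˣ))), hLmem w _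
      ((norm_unit_sub_one_le hN _ (hNu _)).trans_lt (by norm_num))⟩
  have hdep : ¬ LinearIndependent ℚ_[p] f := fun hli => by
    have := hli.fintype_card_le_finrank
    rw [Fintype.card_fin, Module.finrank_pi_fintype] at this
    exact absurd ((this.trans (Finset.sum_le_sum fun w _ => hLcard w)).trans hsum) hlt.not_ge
  rw [Fintype.not_linearIndependent_iff] at hdep
  obtain ⟨b, hb, i₀, hi₀⟩ := hdep
  obtain ⟨i, -, hi⟩ := Finset.exists_max_image Finset.univ (fun j => ‖b j‖) ⟨i₀, Finset.mem_univ _⟩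
  have hbi : 0 < ‖b i‖ := (norm_pos_iff.2 hi₀).trans_le (hi _ (Finset.mem_univ _))
  let a : Fin k → ℤ_[p] := fun j => ⟨b j / b i, by
    rw [norm_div]; exact div_le_one_of_le₀ (hi _ (Finset.mem_univ _)) hbi.le⟩
  obtain ⟨c, hc⟩ := exists_int_seq_tendsto a
  have hrel : ∀ w : Γ, ∑ j, algebraMap ℚ_[p] C (a j) *
      plog C (τ w (algebraMap (𝓞 M) M (u j ^ N : (𝓞 M)ˣ))) = 0 := fun w => by
    have h1 := congrArg (fun x : (w : Γ) → L w => ((x w : L w) : C)) hb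
    simp only [Finset.sum_apply, Pi.smul_apply, Pi.zero_apply, Submodule.coe_sum,
      Submodule.coe_smul, Submodule.coe_zero, Algebra.smul_def] at h1
    have h2 := congrArg (fun x => (algebraMap ℚ_[p] C (b i))⁻¹ * x) h1
    simp only [Finset.mul_sum, mul_zero] at h2
    rw [← h2]
    refine Finset.sum_congr rfl fun j _ => ?_
    simp only [a, f, map_div₀]
    ring
  have hzp : ZpRel p M Γ u (fun j => a j * N) := by
    refine ⟨fun m j => N * c m j, fun j => ?_, fun v hv => ?_⟩
    · have := (hc j).mul_const (N : ℤ_[p])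
      refine this.congr fun m => ?_
      push_cast; ring
    · have := (tendsto_locEmb_prod_iff hpadic (hΓp v hv) (hτ ⟨v, hv⟩)
        (fun j => hNu (u j)) hc).2 (hrel ⟨v, hv⟩)
      refine this.congr fun m => ?_
      rw [locEmb_prod, locEmb_prod]
      simp only [zpow_mul, zpow_natCast]
  have h0 := congrFun (hu _ hzp) i
  have hai : a i = 1 := Subtype.ext (div_self (norm_pos_iff.1 hbi))
  rw [hai, one_mul, Pi.zero_apply, Nat.cast_eq_zero] at h0
  omega

lemma le_rank_of_independent {Γ : Set (HeightOneSpectrum (𝓞 M))} {k : ℕ} {u : Fin k → (𝓞 M)ˣ}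
    (hu : ∀ a : Fin k → ℤ_[p], ZpRel p M Γ u a → a = 0) : k ≤ NumberField.Units.rank M := by
  by_contra! hlt
  obtain ⟨c, hc0, hc⟩ := exists_unit_relation hlt u
  refine hc0 (funext fun j => ?_)
  have := congrFun (hu (fun j => (c j : ℤ_[p])) ⟨fun _ => c, fun j => tendsto_const_nhds,
    fun v _ => by
      simp_rw [locEmb_prod, hc]
      simp [locEmb]⟩) j
  simpa using this

end UpperBound

/-- If the entries `ℓ g` with `g ≠ 1` are algebraically independent and all entries sum to zero, then
every minor of the group matrix on fewer than `|G|` group elements is nonzero. -/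
lemma det_groupMatrix_ne_zero {G : Type*} [Group G] [Fintype G] {C : Type*} [Field C] [CharZero C]
    {ℓ : G → C} (hsum : ∑ g, ℓ g = 0)
    (hind : AlgebraicIndependent ℚ (fun g : {g : G // g ≠ 1} => ℓ g)) {ι : Type*} [Fintype ι]
    [DecidableEq ι] (e : ι ↪ G) (hcard : Fintype.card ι < Fintype.card G) :
    (Matrix.of fun i j => ℓ (e i * (e j)⁻¹)).det ≠ 0 := by
  classical
  let X : G → MvPolynomial {g : G // g ≠ 1} ℚ := fun g =>
    if h : g ≠ 1 then MvPolynomial.X ⟨g, h⟩ else -∑ x, MvPolynomial.X x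
  have hX : ∀ g, MvPolynomial.aeval (fun g : {g : G // g ≠ 1} => ℓ g) (X g) = ℓ g := by
    intro g
    by_cases h : g = 1
    · subst h
      have := Fintype.sum_eq_add_sum_subtype_ne ℓ 1
      rw [hsum] at this
      simp only [X, ne_eq, not_true_eq_false, dite_false, map_neg, map_sum, MvPolynomial.aeval_X]
      linear_combination this
    · simp [X, h]
  have hXev : ∀ g, MvPolynomial.eval (fun _ => (-1 : ℚ)) (X g)
      = if g = 1 then (Fintype.card G : ℚ) - 1 else -1 := by
    intro g
    by_cases h : g = 1
    · subst h
      have : (Fintype.card {g : G // g ≠ 1} : ℚ) = (Fintype.card G : ℚ) - 1 := by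
        rw [Fintype.card_subtype_compl, Fintype.card_subtype_eq,
          Nat.cast_sub Fintype.card_pos, Nat.cast_one]
      simp [X, ← this]
    · simp [X, h]
  intro hdet
  let P : MvPolynomial {g : G // g ≠ 1} ℚ := (Matrix.of fun i j => X (e i * (e j)⁻¹)).det
  have hP : P = 0 := by
    refine (injective_iff_map_eq_zero _).1 hind P ?_
    rw [AlgHom.map_det, ← hdet]
    congr 1
    ext i j
    exact hX _
  have hQ : (Matrix.of fun i j : ι => if i = j then (Fintype.card G : ℚ) - 1 else -1).det = 0 := by
    have := congrArg (MvPolynomial.eval (fun _ => (-1 : ℚ))) hP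
    rw [map_zero, RingHom.map_det] at this
    rw [← this]
    congr 1
    ext i j
    simp only [Matrix.of_apply, RingHom.mapMatrix_apply, Matrix.map_apply, hXev, mul_inv_eq_one,
      e.injective.eq_iff]
  refine det_ne_zero_of_sum_row_lt_diag (fun i => ?_) hQ
  have h1 : ∑ j ∈ Finset.univ.erase i,
      ‖(Matrix.of fun i j : ι => if i = j then (Fintype.card G : ℚ) - 1 else -1) i j‖
        = (Fintype.card ι : ℝ) - 1 := by
    rw [Finset.sum_congr rfl (g := fun _ => (1 : ℝ))]
    · have : 0 < Fintype.card ι := Fintype.card_pos_iff.2 ⟨i⟩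
      simp [Finset.card_erase_of_mem, Nat.cast_sub this]
    · intro j hj
      simp [(Finset.ne_of_mem_erase hj).symm]
  have h2 : (Matrix.of fun i j : ι => if i = j then (Fintype.card G : ℚ) - 1 else -1) i i
      = (Fintype.card G : ℚ) - 1 := by simp
  have hc : (Fintype.card ι : ℝ) < Fintype.card G := by exact_mod_cast hcard
  rw [h1, h2]
  refine lt_of_lt_of_le ?_ (le_abs_self _)
  push_cast
  linarith

section LowerBound

variable {p : ℕ} [Fact p.Prime] {M : Type*} [Field M] [NumberField M] [IsGalois ℚ M]
  {C : Type*} [NormedField C] [CompleteSpace C] [CharZero C]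

omit [Fact p.Prime] [IsGalois ℚ M] in
lemma memY_of_mem_congrUnits {Γ : Set (HeightOneSpectrum (𝓞 M))}
    (hΓp : ∀ v ∈ Γ, (p : 𝓞 M) ∈ v.asIdeal) {u : (𝓞 M)ˣ} (hu : u ∈ congrUnits p M) :
    MemY M Γ u := by
  intro v hv
  have hmem : (u : 𝓞 M) - 1 ∈ v.asIdeal :=
    v.asIdeal.mem_of_dvd (mem_congrUnits.1 hu) (v.asIdeal.pow_mem_of_mem (hΓp v hv) 2 two_pos)
  rw [valued_locEmb_sub_one]
  have := (HeightOneSpectrum.valuation_lt_one_iff_mem (K := M) v _).2 hmem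
  simpa using this

/-- The logarithms of the nontrivial conjugates of a sufficiently generic unit are algebraically
independent under Schanuel's conjecture. -/
lemma algebraicIndependent_plog_galUnit (hSch : PadicSchanuel C)
    (hN : ∀ k : ℕ, ‖(k : C)‖ = ‖(k : ℚ_[p])‖) (τ : M →+* C) {u : (𝓞 M)ˣ}
    (hu : ∀ g, galUnit g u ∈ congrUnits p M)
    (hind : ∀ c : (M ≃ₐ[ℚ] M) → ℤ, ∏ g, galUnit g u ^ c g = 1 → ∀ g h, c g = c h) :
    AlgebraicIndependent ℚ (fun g : {g : M ≃ₐ[ℚ] M // g ≠ 1} =>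
      plog C (τ (algebraMap (𝓞 M) M (galUnit g.1 u)))) := by
  classical
  have hli : LinearIndependent ℚ (fun g : {g : M ≃ₐ[ℚ] M // g ≠ 1} =>
      plog C (τ (algebraMap (𝓞 M) M (galUnit g.1 u)))) := by
    rw [← LinearIndependent.iff_fractionRing (R := ℤ) (K := ℚ), Fintype.linearIndependent_iff]
    intro c hc
    simp only [zsmul_eq_mul] at hc
    rw [← plog_unit_prod hN τ _ (fun g : {g : M ≃ₐ[ℚ] M // g ≠ 1} => hu g.1)] at hc
    have hmem : ∏ g : {g : M ≃ₐ[ℚ] M // g ≠ 1}, galUnit g.1 u ^ c g ∈ congrUnits p M :=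
      Subgroup.prod_mem _ fun g _ => Subgroup.zpow_mem _ (hu _) _
    have h1 := norm_plog hN (norm_unit_sub_one_le hN τ hmem)
    rw [hc, norm_zero, eq_comm, norm_eq_zero, sub_eq_zero] at h1
    have h2 : ∏ g : {g : M ≃ₐ[ℚ] M // g ≠ 1}, galUnit g.1 u ^ c g = 1 :=
      units_ext_algebraMap (τ.injective (by rw [h1]; simp))
    let c' : (M ≃ₐ[ℚ] M) → ℤ := fun g => if h : g ≠ 1 then c ⟨g, h⟩ else 0
    have h3 := hind c' (by
      rw [Fintype.prod_eq_mul_prod_subtype_ne _ 1, ← h2]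
      simp only [c', ne_eq, not_true_eq_false, dite_false, zpow_zero, one_mul]
      exact Finset.prod_congr rfl fun g _ => by simp [g.2])
    intro g
    have := h3 g.1 1
    simpa [c', g.2] using this
  let e := Fintype.equivFin {g : M ≃ₐ[ℚ] M // g ≠ 1}
  have := hSch _ (fun i => τ (algebraMap (𝓞 M) M (galUnit (e.symm i).1 u))) (fun i => ?_)
    (fun i => (norm_unit_sub_one_le hN τ (hu _)).trans_lt (by norm_num))
    (hli.comp e.symm e.symm.injective)
  · exact (algebraicIndependent_equiv e.symm).1 this
  · exact (Algebra.IsAlgebraic.isAlgebraic (R := ℚ) _).algHom τ.toRatAlgHom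

lemma exists_independent_units [Algebra ℚ_[p] C] (hSch : PadicSchanuel C)
    (hpadic : ∀ x : ℚ_[p], ‖algebraMap ℚ_[p] C x‖ = ‖x‖)
    (htr : ∀ (τ : M →+* ℂ) (x : M), (τ x).im = 0) {Γ : Set (HeightOneSpectrum (𝓞 M))}
    (hΓp : ∀ v ∈ Γ, (p : 𝓞 M) ∈ v.asIdeal) (τ : M →+* C) {k : ℕ}
    (hk : k ≤ NumberField.Units.rank M) (e : Fin k ↪ (M ≃ₐ[ℚ] M))
    (he : ∀ i, ∃ w ∈ Γ, InducesPrime (τ.comp (e i : M →+* M)) w) :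
    ∃ u : Fin k → (𝓞 M)ˣ, (∀ j, MemY M Γ (u j)) ∧
      ∀ a : Fin k → ℤ_[p], ZpRel p M Γ u a → a = 0 := by
  have hN := norm_natCast_of_padic hpadic
  obtain ⟨N, hN0, hNu⟩ := exists_pow_mem_congrUnits (M := M) p
  obtain ⟨u₀, hu₀⟩ := exists_unit_galois_independent htr
  let u : (𝓞 M)ˣ := u₀ ^ N
  have hu : ∀ g, galUnit g u ∈ congrUnits p M := fun g => by
    rw [map_pow]; exact hNu _
  have hind : ∀ c : (M ≃ₐ[ℚ] M) → ℤ, ∏ g, galUnit g u ^ c g = 1 → ∀ g h, c g = c h := by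
    intro c hc g h
    have := hu₀ (fun g => N * c g) (by
      rw [← hc]
      exact Finset.prod_congr rfl fun g _ => by rw [map_pow, zpow_mul, zpow_natCast]) g h
    exact mul_left_cancel₀ (by exact_mod_cast hN0.ne') this
  let ℓ : (M ≃ₐ[ℚ] M) → C := fun g => plog C (τ (algebraMap (𝓞 M) M (galUnit g u)))
  have hsum : ∑ g, ℓ g = 0 := by
    have h1 := plog_unit_prod hN τ Finset.univ hu (fun _ => 2)
    have h2 : ∏ g : M ≃ₐ[ℚ] M, galUnit g u ^ (2 : ℤ) = 1 := by
      rw [Finset.prod_zpow]; exact_mod_cast sq_prod_galUnit u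
    rw [h2, ← Finset.mul_sum] at h1
    have h3 : plog C (τ (algebraMap (𝓞 M) M (1 : (𝓞 M)ˣ))) = 0 := by simp [plog]
    rw [h3] at h1
    simpa [ℓ] using h1.symm
  have hcard : Fintype.card (Fin k) < Fintype.card (M ≃ₐ[ℚ] M) := by
    have := card_galois_eq_rank_add_one htr
    rw [Nat.card_eq_fintype_card] at this
    rw [Fintype.card_fin]
    omega
  have hdet := det_groupMatrix_ne_zero hsum
    (algebraicIndependent_plog_galUnit hSch hN τ hu hind) e hcard
  have hmem : ∀ j, galUnit (e j)⁻¹ u ∈ congrUnits p M := fun j => hu _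
  refine ⟨fun j => galUnit (e j)⁻¹ u, fun j => memY_of_mem_congrUnits hΓp (hmem j), ?_⟩
  rintro a ⟨c, hc, hrel⟩
  have hzero : (Matrix.of fun i j => ℓ (e i * (e j)⁻¹)).mulVec
      (fun j => algebraMap ℚ_[p] C (a j)) = 0 := by
    ext i
    obtain ⟨w, hw, hiw⟩ := he i
    have := (tendsto_locEmb_prod_iff hpadic (hΓp w hw) hiw hmem hc).1 (hrel w hw)
    rw [Pi.zero_apply, ← this, Matrix.mulVec, dotProduct]
    refine Finset.sum_congr rfl fun j _ => ?_
    rw [mul_comm, Matrix.of_apply]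
    congr 2
    simp only [ℓ]
    rw [← galUnit_galUnit, coe_galUnit]
    rfl
  have h0 := Matrix.eq_zero_of_mulVec_eq_zero hdet hzero
  funext j
  have := congrFun h0 j
  simpa using this

end LowerBound

section GaloisEmbeddings

variable {M : Type*} [Field M] [NumberField M] [IsGalois ℚ M] {C : Type*} [Field C] [CharZero C]
  [IsAlgClosed C]

lemma comp_galois_bijective (σ : M →+* C) :
    Function.Bijective (fun g : M ≃ₐ[ℚ] M => σ.comp (g : M →+* M)) := by
  rw [Nat.bijective_iff_injective_and_card]
  refine ⟨fun g h hgh => ?_, ?_⟩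
  · ext x
    exact σ.injective (DFunLike.congr_fun hgh x)
  · rw [IsGalois.card_aut_eq_finrank, Nat.card_eq_fintype_card, NumberField.Embeddings.card]

lemma ncard_compl_SpOfGamma_add (Γ : Set (HeightOneSpectrum (𝓞 M))) (v0 : HeightOneSpectrum (𝓞 M))
    (ι : v0.adicCompletion M →+* C) :
    Set.ncard (SpOfGamma M C Γ v0 ι)ᶜ
      + Set.ncard {g : M ≃ₐ[ℚ] M | ∃ w ∈ Γ, w.asIdeal = Ideal.comap (gOhom M g) v0.asIdeal}
      = Nat.card (M ≃ₐ[ℚ] M) := by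
  have hbij := comp_galois_bijective (ι.comp (algebraMap M (v0.adicCompletion M)))
  have hS : SpOfGamma M C Γ v0 ι
      = (fun g : M ≃ₐ[ℚ] M => (ι.comp (algebraMap M (v0.adicCompletion M))).comp (g : M →+* M)) ''
        {g | ∃ w ∈ Γ, w.asIdeal = Ideal.comap (gOhom M g) v0.asIdeal} := by
    ext σ
    constructor
    · rintro ⟨g, rfl, hg⟩
      exact ⟨g, hg, rfl⟩
    · rintro ⟨g, hg, rfl⟩
      exact ⟨g, rfl, hg⟩
  rw [← Set.ncard_image_of_injective _ hbij.injective, ← hS, add_comm, Set.ncard_add_ncard_compl,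
    Nat.card_eq_of_bijective _ hbij]

end GaloisEmbeddings

lemma ZpRankClosure_eq_min {p : ℕ} [Fact p.Prime] {M : Type*} [Field M] [NumberField M]
    [IsGalois ℚ M] {C : Type*} [NormedField C] [CompleteSpace C] [IsAlgClosed C] [CharZero C]
    [Algebra ℚ_[p] C] (hpadic : ∀ x : ℚ_[p], ‖algebraMap ℚ_[p] C x‖ = ‖x‖)
    (htr : ∀ (τ : M →+* ℂ) (x : M), (τ x).im = 0) {Γ : Set (HeightOneSpectrum (𝓞 M))}
    (hΓp : ∀ v ∈ Γ, (p : 𝓞 M) ∈ v.asIdeal) {v0 : HeightOneSpectrum (𝓞 M)} (hv0 : v0 ∈ Γ)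
    (hSch : PadicSchanuel C) :
    ZpRankClosure p M Γ =
      min (Set.ncard {g : M ≃ₐ[ℚ] M | ∃ w ∈ Γ, w.asIdeal = Ideal.comap (gOhom M g) v0.asIdeal})
        (NumberField.Units.rank M) := by
  have hN := norm_natCast_of_padic hpadic
  have : IsUltrametricDist C := isUltrametricDist_of_natCast hN
  obtain ⟨τ, hτ⟩ := exists_inducesPrime (C := C) hN (hΓp v0 hv0)
  set A := {g : M ≃ₐ[ℚ] M | ∃ w ∈ Γ, w.asIdeal = Ideal.comap (gOhom M g) v0.asIdeal} with hA
  have hbij := comp_galois_bijective τ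
  refine IsGreatest.csSup_eq ⟨?_, ?_⟩
  · let e : Fin (min A.ncard (NumberField.Units.rank M)) ↪ (M ≃ₐ[ℚ] M) :=
      ((Fin.castLEEmb (min_le_left _ _)).trans (Finite.equivFin A).symm.toEmbedding).trans
        (Function.Embedding.subtype _)
    have heA : ∀ i, e i ∈ A := fun i => Subtype.coe_prop _
    refine exists_independent_units hSch hpadic htr hΓp τ (min_le_right _ _) e fun i => ?_
    obtain ⟨w, hw, hwi⟩ := heA i
    exact ⟨w, hw, (inducesPrime_comp_iff hτ _).2 hwi⟩
  · rintro k ⟨u, -, hu⟩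
    refine le_min ?_ (le_rank_of_independent hu)
    refine (le_card_inducesPrime_of_independent (C := C) hpadic hΓp hu).trans_eq ?_
    rw [← Set.ncard_image_of_injective A hbij.injective, ← Nat.card_coe_set_eq]
    congr 2
    ext σ
    constructor
    · rintro ⟨w, hw, h⟩
      obtain ⟨g, rfl⟩ := hbij.surjective σ
      exact ⟨g, ⟨w, hw, (inducesPrime_comp_iff hτ g).1 h⟩, rfl⟩
    · rintro ⟨g, ⟨w, hw, h⟩, rfl⟩
      exact ⟨w, hw, (inducesPrime_comp_iff hτ g).2 h⟩

/-- Suppose `M` is totally real. Let `Γ` be a nonempty set of primes of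
`O_M` above `p`, let `S_p ⊆ E_p` be the subset determined by `Γ`, and `t = |E_p ∖ S_p|`.
Assuming the `p`-adic Schanuel conjecture, the `ℤ_p`-rank of the closure of `Δ_Γ(Y)` equals
`r − (t−1)⁺`. -/
theorem stmt5
    (Cp : Type*) [NormedField Cp] [CompleteSpace Cp] [IsAlgClosed Cp] [CharZero Cp]
    [Algebra ℚ_[p] Cp] (hpadic : ∀ x : ℚ_[p], ‖algebraMap ℚ_[p] Cp x‖ = ‖x‖)
    (hiso : Nonempty (Cp ≃+* ℂ))
    (htr : ∀ (τ : M →+* ℂ) (x : M), (τ x).im = 0)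
    (Γ : Set (HeightOneSpectrum (𝓞 M))) (hΓne : Γ.Nonempty)
    (hΓp : ∀ v ∈ Γ, (p : 𝓞 M) ∈ v.asIdeal)
    (v0 : HeightOneSpectrum (𝓞 M)) (hv0 : v0 ∈ Γ)
    (ι : v0.adicCompletion M →+* Cp)
    (hSch : PadicSchanuel Cp) :
    (ZpRankClosure p M Γ : ℤ) =
      (NumberField.Units.rank M : ℤ) -
        max ((Set.ncard (SpOfGamma M Cp Γ v0 ι)ᶜ : ℤ) - 1) 0 := by

  have h1 := ncard_compl_SpOfGamma_add Γ v0 ι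
  rw [card_galois_eq_rank_add_one htr] at h1
  rw [ZpRankClosure_eq_min hpadic htr hΓp hv0 hSch]
  omega
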